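/- Let P : V_ℝ → V_ℝ be a real-linear map with P(C_ℝ \ {0}) ⊆ C_ℝ \ {0}, and let P also denote its complex-linear extension to V_ℂ (P(u + i·v) = P u + i·P v). Then P maps C = C_ℂ \ {0} into itself, and Δ_ℂ ≤ 3·Δ_ℝ, where Δ_ℝ = sup{h_{C_ℝ}(P u, P v) : u, v ∈ C_ℝ \ {0}} and Δ_ℂ = sup{δ_C(P w, P w') : w, w' ∈ C}. -/

import Mathlib

open Complex

/-- Logarithm on `[0,∞]` with values in `[-∞,∞]`. -/
noncomputable def elog (x : ENNReal) : EReal :=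
  if x = 0 then ⊥ else if x = ⊤ then ⊤ else (Real.log x.toReal : EReal)

/-- The complex cone `ℂ*·(C_ℝ + i·C_ℝ) \ {0}` generated by a real cone `Cr`. -/
def complexCone {V : Type*} [AddCommGroup V] [Module ℂ V] (Cr : Set V) : Set V :=
  {x | x ≠ 0 ∧ ∃ c : ℂ, c ≠ 0 ∧ ∃ u ∈ Cr, ∃ v ∈ Cr, x = c • (u + Complex.I • v)}

/-- `E_C(x,y) = {z ∈ ℂ : z•x − y ∉ C}`. -/
def ECset {V : Type*} [AddCommGroup V] [Module ℂ V] (Cc : Set V) (x y : V) : Set ℂ :=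
  {z | z • x - y ∉ Cc}

/-- The projective metric `δ_C(x,y) = log(b/a)` of a complex cone. -/
noncomputable def deltaC {V : Type*} [AddCommGroup V] [Module ℂ V]
    (Cc : Set V) (x y : V) : EReal :=
  elog ((⨆ z ∈ ECset Cc x y, (‖z‖₊ : ENNReal)) / (⨅ z ∈ ECset Cc x y, (‖z‖₊ : ENNReal)))

/-- The Hilbert metric `h_{C_ℝ}(u,v) = log(β/α)` of a real cone. -/
noncomputable def hilbertMetric {V : Type*} [AddCommGroup V] [Module ℝ V]
    (Cr : Set V) (u v : V) : EReal :=
  elog ((sInf {t : ENNReal | ∃ s : ℝ, 0 < s ∧ t = ENNReal.ofReal s ∧ s • u - v ∈ Cr}) /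
        (sSup {t : ENNReal | ∃ s : ℝ, 0 ≤ s ∧ t = ENNReal.ofReal s ∧ v - s • u ∈ Cr}))

/-- The dual cone `C_ℝ'`: complex-linear extensions of the continuous real-linear
functionals on `V_ℝ` that are nonnegative on `C_ℝ`. -/
noncomputable def dualCone {V : Type*} [NormedAddCommGroup V] [NormedSpace ℂ V]
    (Vr : Submodule ℝ V) (Cr : Set V) : Set (V →L[ℂ] ℂ) :=
  {l | (∀ u ∈ Vr, (l u).im = 0) ∧ ∀ u ∈ Cr, 0 ≤ (l u).re}


section

variable {V : Type*} [NormedAddCommGroup V] [NormedSpace ℂ V]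

/-- Complex-linear extensions of real functionals on `Vr` that are nonnegative on `Cr`. -/
def positiveFunctionals (Vr : Submodule ℝ V) (Cr : Set V) : Set (V →ₗ[ℂ] ℂ) :=
  {l | (∀ u ∈ Vr, (l u).im = 0) ∧ ∀ u ∈ Cr, 0 ≤ (l u).re}

/-- Combinations `a • l₁ + b • l₂` of positive functionals whose coefficients make an angle of at
most `π / 2`. -/
def acuteFunctionals (Vr : Submodule ℝ V) (Cr : Set V) : Set (V →ₗ[ℂ] ℂ) :=
  {F | ∃ l₁ ∈ positiveFunctionals Vr Cr, ∃ l₂ ∈ positiveFunctionals Vr Cr, ∃ a b : ℂ,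
    0 ≤ (a * (starRingEnd ℂ) b).re ∧ F = a • l₁ + b • l₂}

/-- `α • p ≤ q ≤ β • p`, tested against all positive functionals. -/
def IsPinched (Vr : Submodule ℝ V) (Cr : Set V) (α β : ℝ) (p q : V) : Prop :=
  ∀ l ∈ positiveFunctionals Vr Cr, α * (l p).re ≤ (l q).re ∧ (l q).re ≤ β * (l p).re

/-- Every real functional extends complex-linearly from a real form. -/
lemma exists_complex_extension {Vr : Submodule ℝ V}
    (hSpan : ∀ x : V, ∃ u ∈ Vr, ∃ v ∈ Vr, x = u + Complex.I • v)
    (hUniq : ∀ u ∈ Vr, ∀ v ∈ Vr, u + Complex.I • v = 0 → u = 0 ∧ v = 0) (f : V →ₗ[ℝ] ℝ) :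
    ∃ l : V →ₗ[ℂ] ℂ, ∀ u ∈ Vr, l u = f u := by
  choose U hU W hW hUW using hSpan
  have key : ∀ u ∈ Vr, ∀ v ∈ Vr, ∀ x, x = u + Complex.I • v → U x = u ∧ W x = v := by
    intro u hu v hv x hx
    have h := hUniq (U x - u) (Vr.sub_mem (hU x) hu) (W x - v) (Vr.sub_mem (hW x) hv) (by
      have h1 := hUW x
      have h2 : U x + Complex.I • W x = u + Complex.I • v := h1.symm.trans hx
      rw [smul_sub, sub_add_sub_comm, h2, sub_self])
    exact ⟨sub_eq_zero.1 h.1, sub_eq_zero.1 h.2⟩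
  refine ⟨{ toFun := fun x => f (U x) + f (W x) * Complex.I, map_add' := ?_, map_smul' := ?_ }, ?_⟩
  · intro x y
    obtain ⟨h1, h2⟩ := key (U x + U y) (Vr.add_mem (hU x) (hU y)) (W x + W y)
      (Vr.add_mem (hW x) (hW y)) (x + y) (by
        rw [smul_add, add_add_add_comm, ← hUW x, ← hUW y])
    rw [h1, h2, map_add, map_add]
    push_cast
    ring
  · intro c x
    obtain ⟨h1, h2⟩ := key (c.re • U x - c.im • W x)
      (Vr.sub_mem (Vr.smul_mem _ (hU x)) (Vr.smul_mem _ (hW x))) (c.re • W x + c.im • U x)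
      (Vr.add_mem (Vr.smul_mem _ (hW x)) (Vr.smul_mem _ (hU x))) (c • x) (by
        have hc : c • x = (c.re + c.im * Complex.I) • (U x + Complex.I • W x) := by
          rw [Complex.re_add_im, ← hUW x]
        rw [hc]
        simp only [← Complex.coe_smul]
        match_scalars
        · ring
        · linear_combination (c.im : ℂ) * Complex.I_mul_I)
    simp only [h1, h2, map_sub, map_add, map_smul, smul_eq_mul, RingHom.id_apply]
    apply Complex.ext <;> simp
  · intro u hu
    obtain ⟨h1, h2⟩ := key u hu 0 Vr.zero_mem u (by simp)
    simp [h1, h2]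

/-- A vector of the real form outside a closed convex cone is separated from it by a positive
functional. -/
lemma exists_positiveFunctional_neg {Vr : Submodule ℝ V}
    (hSpan : ∀ x : V, ∃ u ∈ Vr, ∃ v ∈ Vr, x = u + Complex.I • v)
    (hUniq : ∀ u ∈ Vr, ∀ v ∈ Vr, u + Complex.I • v = 0 → u = 0 ∧ v = 0)
    {Cr : Set V} (hCrSub : Cr ⊆ (Vr : Set V)) (hCrClosed : IsClosed Cr) (hCrNe : Cr.Nonempty)
    (hCrAdd : ∀ u ∈ Cr, ∀ v ∈ Cr, u + v ∈ Cr)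
    (hCrSmul : ∀ t : ℝ, 0 ≤ t → ∀ u ∈ Cr, t • u ∈ Cr) {x : V} (hx : x ∈ Vr) (hxC : x ∉ Cr) :
    ∃ l ∈ positiveFunctionals Vr Cr, (l x).re < 0 := by
  have hconv : Convex ℝ Cr := fun u hu v hv a b ha hb _ =>
    hCrAdd _ (hCrSmul a ha u hu) _ (hCrSmul b hb v hv)
  obtain ⟨f, s, hf, hs⟩ := geometric_hahn_banach_closed_point hconv hCrClosed hxC
  obtain ⟨l, hl⟩ := exists_complex_extension hSpan hUniq (-f.toLinearMap)
  have hs0 : 0 < s := by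
    obtain ⟨u, hu⟩ := hCrNe
    simpa using hf _ (hCrSmul 0 le_rfl u hu)
  refine ⟨l, ⟨fun u hu => by rw [hl u hu, Complex.ofReal_im], fun u hu => ?_⟩, ?_⟩
  · rw [hl u (hCrSub hu)]
    by_contra! hneg
    simp only [Complex.ofReal_re, LinearMap.neg_apply, ContinuousLinearMap.coe_coe] at hneg
    have hfu : 0 < f u := by linarith
    have h := hf _ (hCrSmul (s / f u) (by positivity) u hu)
    rw [map_smul, smul_eq_mul, div_mul_cancel₀ _ hfu.ne'] at h
    exact lt_irrefl _ h
  · rw [hl x hx]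
    simp only [Complex.ofReal_re, LinearMap.neg_apply, ContinuousLinearMap.coe_coe]
    linarith

/-- A family of complex numbers making pairwise acute angles can be rotated into the first
quadrant. -/
lemma exists_rotation_into_quadrant {D : Set ℂ}
    (hD : ∀ d ∈ D, ∀ e ∈ D, 0 ≤ (d * (starRingEnd ℂ) e).re) :
    ∃ c : ℂ, c ≠ 0 ∧ ∀ d ∈ D, 0 ≤ (c * d).re ∧ 0 ≤ (c * d).im := by
  by_cases h0 : ∃ d₀ ∈ D, d₀ ≠ 0
  swap
  · push Not at h0
    exact ⟨1, one_ne_zero, fun d hd => by simp [h0 d hd]⟩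
  obtain ⟨d₀, hd₀, hne⟩ := h0
  set b : ℂ := (starRingEnd ℂ) d₀ with hb
  have hbne : b ≠ 0 := by simpa [hb] using hne
  set A : Set ℝ := (fun d => (d * b).arg) '' (D \ {0})
  have habs : ∀ d ∈ D, |(d * b).arg| ≤ Real.pi / 2 := fun d hd =>
    Complex.abs_arg_le_pi_div_two_iff.2 (hD d hd d₀ hd₀)
  have hAne : A.Nonempty := ⟨_, d₀, ⟨hd₀, hne⟩, rfl⟩
  have hAb : BddBelow A := ⟨-(Real.pi / 2), by
    rintro _ ⟨d, hd, rfl⟩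
    exact (abs_le.1 (habs d hd.1)).1⟩
  have hpolar : ∀ d : ℂ, d * b = ‖d * b‖ * Complex.exp ((d * b).arg * Complex.I) := fun d =>
    (Complex.norm_mul_exp_arg_mul_I _).symm
  have hdiff : ∀ d ∈ D \ {0}, ∀ e ∈ D \ {0}, (d * b).arg - (e * b).arg ≤ Real.pi / 2 := by
    intro d hd e he
    by_contra! hlt
    have hd1 := abs_le.1 (habs d hd.1)
    have he1 := abs_le.1 (habs e he.1)
    have hcos : Real.cos ((d * b).arg - (e * b).arg) < 0 :=
      Real.cos_neg_of_pi_div_two_lt_of_lt hlt (by linarith [Real.pi_pos])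
    have hpos : 0 ≤ ((d * b) * (starRingEnd ℂ) (e * b)).re := by
      have h1 : (d * b) * (starRingEnd ℂ) (e * b)
          = ((Complex.normSq b : ℝ) : ℂ) * (d * (starRingEnd ℂ) e) := by
        rw [map_mul, Complex.normSq_eq_conj_mul_self]
        ring
      rw [h1, Complex.re_ofReal_mul]
      exact mul_nonneg (Complex.normSq_nonneg _) (hD d hd.1 e he.1)
    have hval : ((d * b) * (starRingEnd ℂ) (e * b)).re
        = ‖d * b‖ * ‖e * b‖ * Real.cos ((d * b).arg - (e * b).arg) := by
      rw [Real.cos_sub, Complex.mul_re, Complex.conj_re, Complex.conj_im]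
      linear_combination (-(e * b).re) * Complex.norm_mul_cos_arg (d * b)
        - ‖d * b‖ * Real.cos (d * b).arg * Complex.norm_mul_cos_arg (e * b)
        - (e * b).im * Complex.norm_mul_sin_arg (d * b)
        - ‖d * b‖ * Real.sin (d * b).arg * Complex.norm_mul_sin_arg (e * b)
    have hd2 : 0 < ‖d * b‖ := norm_pos_iff.2 (mul_ne_zero hd.2 hbne)
    have he2 : 0 < ‖e * b‖ := norm_pos_iff.2 (mul_ne_zero he.2 hbne)
    have := mul_neg_of_pos_of_neg (mul_pos hd2 he2) hcos
    linarith
  refine ⟨Complex.exp (-(sInf A : ℝ) * Complex.I) * b,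
    mul_ne_zero (Complex.exp_ne_zero _) hbne, fun d hd => ?_⟩
  by_cases hd0 : d = 0
  · simp [hd0]
  have h1 : sInf A ≤ (d * b).arg := csInf_le hAb ⟨d, ⟨hd, hd0⟩, rfl⟩
  have h2 : (d * b).arg - Real.pi / 2 ≤ sInf A := by
    refine le_csInf hAne ?_
    rintro _ ⟨e, he, rfl⟩
    have := hdiff d ⟨hd, hd0⟩ e he
    simp only
    linarith
  have heq : Complex.exp (-(sInf A : ℝ) * Complex.I) * b * d
      = (‖d * b‖ : ℝ) * Complex.exp (((d * b).arg - sInf A : ℝ) * Complex.I) := by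
    calc _ = Complex.exp (-(sInf A : ℝ) * Complex.I) * (d * b) := by ring
      _ = ‖d * b‖ * (Complex.exp (-(sInf A : ℝ) * Complex.I) *
          Complex.exp ((d * b).arg * Complex.I)) := by
        conv_lhs => rw [hpolar d]
        ring
      _ = _ := by
        rw [← Complex.exp_add]
        congr 2
        push_cast
        ring
  rw [heq, Complex.re_ofReal_mul, Complex.im_ofReal_mul, Complex.exp_ofReal_mul_I_re,
    Complex.exp_ofReal_mul_I_im]
  exact ⟨mul_nonneg (norm_nonneg _)
      (Real.cos_nonneg_of_neg_pi_div_two_le_of_le (by linarith [Real.pi_pos]) (by linarith)),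
    mul_nonneg (norm_nonneg _)
      (Real.sin_nonneg_of_nonneg_of_le_pi (by linarith) (by linarith [Real.pi_pos]))⟩

/-- Nonzero vectors outside the complexified cone are detected by a pair of positive
functionals. -/
lemma exists_obtuse_pair_of_notMem_complexCone {Vr : Submodule ℝ V}
    (hSpan : ∀ x : V, ∃ u ∈ Vr, ∃ v ∈ Vr, x = u + Complex.I • v) {Cr : Set V}
    (hsep : ∀ x ∈ Vr, x ∉ Cr → ∃ l ∈ positiveFunctionals Vr Cr, (l x).re < 0)
    {w : V} (hw0 : w ≠ 0) (hw : w ∉ complexCone Cr) :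
    ∃ l₁ ∈ positiveFunctionals Vr Cr, ∃ l₂ ∈ positiveFunctionals Vr Cr,
      (l₁ w * (starRingEnd ℂ) (l₂ w)).re < 0 := by
  by_contra! h
  obtain ⟨c, hc, hcD⟩ := exists_rotation_into_quadrant
    (D := (fun l : V →ₗ[ℂ] ℂ => l w) '' positiveFunctionals Vr Cr) (by
      rintro _ ⟨l₁, h₁, rfl⟩ _ ⟨l₂, h₂, rfl⟩
      exact h l₁ h₁ l₂ h₂)
  obtain ⟨u, hu, v, hv, huv⟩ := hSpan (c • w)
  have hval : ∀ l ∈ positiveFunctionals Vr Cr, 0 ≤ (l u).re ∧ 0 ≤ (l v).re := by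
    intro l hl
    have h1 := hcD _ ⟨l, hl, rfl⟩
    have h2 : c * l w = l u + Complex.I * l v := by
      rw [← smul_eq_mul, ← map_smul, huv, map_add, map_smul, smul_eq_mul]
    simp only [h2] at h1
    simpa [hl.1 u hu, hl.1 v hv] using h1
  refine hw ⟨hw0, c⁻¹, inv_ne_zero hc, u, ?_, v, ?_, ?_⟩
  · by_contra hn
    obtain ⟨l, hl, hlt⟩ := hsep u hu hn
    exact absurd (hval l hl).1 (not_le.2 hlt)
  · by_contra hn
    obtain ⟨l, hl, hlt⟩ := hsep v hv hn
    exact absurd (hval l hl).2 (not_le.2 hlt)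
  · rw [← huv, smul_smul, inv_mul_cancel₀ hc, one_smul]

/-- The Hilbert metric bounds the spread of the ratios of positive functionals. -/
lemma exists_isPinched_of_hilbertMetric_le {Vr : Submodule ℝ V} {Cr : Set V}
    (hCrSub : Cr ⊆ (Vr : Set V)) (hCrProper : ∀ u ∈ Cr, -u ∈ Cr → u = 0)
    (hsep : ∀ x ∈ Vr, x ∉ Cr → ∃ l ∈ positiveFunctionals Vr Cr, (l x).re < 0)
    {p q : V} (hp : p ∈ Cr) (hp0 : p ≠ 0) (hq : q ∈ Cr) (hq0 : q ≠ 0) {D : ℝ}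
    (h : hilbertMetric Cr p q ≤ (D : EReal)) :
    ∃ α β : ℝ, 0 < α ∧ α ≤ β ∧ β ≤ Real.exp D * α ∧ IsPinched Vr Cr α β p q := by
  have hexpos : ∀ x ∈ Cr, x ≠ 0 → ∃ l ∈ positiveFunctionals Vr Cr, 0 < (l x).re := by
    intro x hx hx0
    obtain ⟨l, hl, hlt⟩ := hsep (-x) (Vr.neg_mem (hCrSub hx)) fun hn => hx0 (hCrProper x hx hn)
    exact ⟨l, hl, by simpa using hlt⟩
  have hre : ∀ (l : V →ₗ[ℂ] ℂ) (s : ℝ) (x : V), (l (s • x)).re = s * (l x).re := by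
    intro l s x
    rw [← Complex.coe_smul, map_smul, smul_eq_mul, Complex.re_ofReal_mul]
  unfold hilbertMetric at h
  set B : ENNReal := sInf {t | ∃ s : ℝ, 0 < s ∧ t = ENNReal.ofReal s ∧ s • p - q ∈ Cr} with hB
  set A : ENNReal := sSup {t | ∃ s : ℝ, 0 ≤ s ∧ t = ENNReal.ofReal s ∧ q - s • p ∈ Cr} with hA
  have hupper : ∀ s : ℝ, 0 < s → B < ENNReal.ofReal s → ∀ l ∈ positiveFunctionals Vr Cr,
      (l q).re ≤ s * (l p).re := by
    intro s hs hBs l hl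
    obtain ⟨_, ⟨s', hs', rfl, hmem⟩, hlt⟩ := sInf_lt_iff.1 hBs
    have h1 := hl.2 _ hmem
    rw [map_sub, Complex.sub_re, hre] at h1
    have h2 : s' < s := (ENNReal.ofReal_lt_ofReal_iff hs).1 hlt
    have h3 := mul_le_mul_of_nonneg_right h2.le (hl.2 p hp)
    linarith
  have hlower : ∀ s : ℝ, 0 ≤ s → ENNReal.ofReal s < A → ∀ l ∈ positiveFunctionals Vr Cr,
      s * (l p).re ≤ (l q).re := by
    intro s hs hAs l hl
    obtain ⟨_, ⟨s', hs', rfl, hmem⟩, hlt⟩ := lt_sSup_iff.1 hAs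
    have h1 := hl.2 _ hmem
    rw [map_sub, Complex.sub_re, hre] at h1
    have h2 : s < s' := (ENNReal.ofReal_lt_ofReal_iff_of_nonneg hs).1 hlt
    have h3 := mul_le_mul_of_nonneg_right h2.le (hl.2 p hp)
    linarith
  have hA_top : A ≠ ⊤ := by
    intro hAt
    obtain ⟨l, hl, hpos⟩ := hexpos p hp hp0
    have hq := hl.2 q hq
    have h1 := hlower ((l q).re / (l p).re + 1) (by positivity)
      (by rw [hAt]; exact ENNReal.ofReal_lt_top) l hl
    rw [add_mul, div_mul_cancel₀ _ hpos.ne'] at h1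
    linarith
  have hB_zero : B ≠ 0 := by
    intro hB0
    obtain ⟨l, hl, hpos⟩ := hexpos q hq hq0
    have hp' := hl.2 p hp
    have hs : 0 < (l q).re / ((l p).re + 1) := by positivity
    have h1 := hupper _ hs (by rw [hB0]; exact ENNReal.ofReal_pos.2 hs) l hl
    rw [div_mul_eq_mul_div, le_div_iff₀ (by positivity)] at h1
    linarith
  have hratio_zero : B / A ≠ 0 := by simp [ENNReal.div_eq_zero_iff, hB_zero, hA_top]
  have hratio_top : B / A ≠ ⊤ := by
    intro ht
    rw [ht, elog, if_neg ENNReal.top_ne_zero, if_pos rfl] at h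
    exact absurd (top_le_iff.1 h) (EReal.coe_ne_top D)
  have hA_zero : A ≠ 0 := fun h0 => hratio_top (by rw [h0]; exact ENNReal.div_zero hB_zero)
  have hB_top : B ≠ ⊤ := fun h0 => hratio_top (by rw [h0]; exact ENNReal.top_div_of_ne_top hA_top)
  have hApos : 0 < A.toReal := ENNReal.toReal_pos hA_zero hA_top
  have hBpos : 0 < B.toReal := ENNReal.toReal_pos hB_zero hB_top
  have hpinch : IsPinched Vr Cr A.toReal B.toReal p q := by
    intro l hl
    have hp' := hl.2 p hp
    constructor
    · by_contra! hlt
      have hp'' : 0 < (l p).re := by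
        refine lt_of_le_of_ne hp' fun h0 => ?_
        rw [← h0, mul_zero] at hlt
        exact absurd (hl.2 q hq) (not_le.2 hlt)
      rw [← div_lt_iff₀ hp''] at hlt
      obtain ⟨s, hs1, hs2⟩ := exists_between hlt
      have hs0 : 0 ≤ s := (div_nonneg (hl.2 q hq) hp').trans hs1.le
      have h1 := hlower s hs0 ((ENNReal.ofReal_lt_iff_lt_toReal hs0 hA_top).2 hs2) l hl
      rw [div_lt_iff₀ hp''] at hs1
      linarith
    · refine le_of_forall_pos_le_add fun ε hε => ?_
      have hδ : 0 < ε / ((l p).re + 1) := by positivity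
      have h1 := hupper (B.toReal + ε / ((l p).re + 1)) (by positivity)
        ((ENNReal.lt_ofReal_iff_toReal_lt hB_top).2 (by linarith)) l hl
      have h2 : ε / ((l p).re + 1) * (l p).re ≤ ε := by
        rw [div_mul_eq_mul_div, div_le_iff₀ (by positivity)]
        nlinarith
      linarith
  refine ⟨A.toReal, B.toReal, hApos, ?_, ?_, hpinch⟩
  · obtain ⟨l, hl, hpos⟩ := hexpos p hp hp0
    have := hpinch l hl
    exact le_of_mul_le_mul_right (this.1.trans this.2) hpos
  · rw [elog, if_neg hratio_zero, if_neg hratio_top, EReal.coe_le_coe_iff, ENNReal.toReal_div,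
      Real.log_le_iff_le_exp (by positivity), div_le_iff₀ hApos] at h
    exact h

/-- Acute combinations are monotone under domination of their arguments. -/
lemma norm_acute_combination_le {a b : ℂ} (hab : 0 ≤ (a * (starRingEnd ℂ) b).re)
    {r s₁ s₂ e₁ e₂ : ℝ} (hr : 0 ≤ r) (h₁ : |e₁| ≤ r * s₁) (h₂ : |e₂| ≤ r * s₂) :
    ‖a * e₁ + b * e₂‖ ≤ r * ‖a * s₁ + b * s₂‖ := by
  have hsq : ∀ x y : ℝ, ‖a * x + b * y‖ ^ 2 = (a.re ^ 2 + a.im ^ 2) * x ^ 2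
      + (b.re ^ 2 + b.im ^ 2) * y ^ 2 + 2 * (a * (starRingEnd ℂ) b).re * (x * y) := by
    intro x y
    rw [Complex.sq_norm, Complex.normSq_apply]
    simp
    ring
  have hs : 0 ≤ r * ‖a * s₁ + b * s₂‖ := by positivity
  refine (sq_le_sq₀ (norm_nonneg _) hs).1 ?_
  have h11 : e₁ ^ 2 ≤ (r * s₁) ^ 2 := sq_le_sq' (abs_le.1 h₁).1 (abs_le.1 h₁).2
  have h22 : e₂ ^ 2 ≤ (r * s₂) ^ 2 := sq_le_sq' (abs_le.1 h₂).1 (abs_le.1 h₂).2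
  have h12 : e₁ * e₂ ≤ (r * s₁) * (r * s₂) := by
    refine (le_abs_self _).trans ?_
    rw [abs_mul]
    exact mul_le_mul h₁ h₂ (abs_nonneg _) ((abs_nonneg _).trans h₁)
  rw [mul_pow, hsq, hsq]
  have k1 := mul_le_mul_of_nonneg_left h11 (by positivity : 0 ≤ a.re ^ 2 + a.im ^ 2)
  have k2 := mul_le_mul_of_nonneg_left h22 (by positivity : 0 ≤ b.re ^ 2 + b.im ^ 2)
  have k3 := mul_le_mul_of_nonneg_left h12 (by positivity : 0 ≤ 2 * (a * (starRingEnd ℂ) b).re)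
  linarith

lemma positiveFunctionals_subset_acuteFunctionals (Vr : Submodule ℝ V) (Cr : Set V) :
    positiveFunctionals Vr Cr ⊆ acuteFunctionals Vr Cr :=
  fun l hl => ⟨l, hl, l, hl, 1, 0, by simp, by simp⟩

/-- An acute functional sends a pinched vector into the disk with diameter `[α, β]`. -/
lemma norm_acuteFunctional_sub_le {Vr : Submodule ℝ V} {Cr : Set V} {α β : ℝ} {p q : V}
    (hp : p ∈ Vr) (hq : q ∈ Vr) (hαβ : α ≤ β) (h : IsPinched Vr Cr α β p q)
    {F : V →ₗ[ℂ] ℂ} (hF : F ∈ acuteFunctionals Vr Cr) :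
    ‖F q - ((α + β) / 2 : ℝ) * F p‖ ≤ (β - α) / 2 * ‖F p‖ := by
  obtain ⟨l₁, h₁, l₂, h₂, a, b, hab, rfl⟩ := hF
  have hreal : ∀ l ∈ positiveFunctionals Vr Cr, ∀ x ∈ Vr, l x = ((l x).re : ℂ) :=
    fun l hl x hx => Complex.ext rfl (by simpa using hl.1 x hx)
  have habs : ∀ l ∈ positiveFunctionals Vr Cr,
      |(l q).re - (α + β) / 2 * (l p).re| ≤ (β - α) / 2 * (l p).re := by
    intro l hl
    have := h l hl
    rw [abs_le]
    constructor <;> linarith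
  have key := norm_acute_combination_le hab (by linarith : 0 ≤ (β - α) / 2) (habs l₁ h₁)
    (habs l₂ h₂)
  have e1 : (a • l₁ + b • l₂) p = a * ((l₁ p).re : ℂ) + b * ((l₂ p).re : ℂ) := by
    rw [← hreal l₁ h₁ p hp, ← hreal l₂ h₂ p hp]
    rfl
  have e2 : (a • l₁ + b • l₂) q = a * ((l₁ q).re : ℂ) + b * ((l₂ q).re : ℂ) := by
    rw [← hreal l₁ h₁ q hq, ← hreal l₂ h₂ q hq]
    rfl
  rw [e1, e2]
  convert key using 2
  push_cast
  ring

/-- The Möbius-type distortion of a disk with diameter `[α, β]` by `τ ↦ 1 + i τ`. -/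
lemma norm_one_add_I_mul_le {α β : ℝ} (hα : 0 < α) (hαβ : α ≤ β) {τ σ : ℂ}
    (hτ : ‖τ - ((α + β) / 2 : ℝ)‖ ≤ (β - α) / 2) (hσ : ‖σ - ((α + β) / 2 : ℝ)‖ ≤ (β - α) / 2) :
    1 + Complex.I * σ ≠ 0 ∧ α * ‖1 + Complex.I * τ‖ ≤ β * ‖1 + Complex.I * σ‖ := by
  set m : ℝ := (α + β) / 2 with hm
  set r : ℝ := (β - α) / 2 with hr
  have hshift : ∀ x : ℂ, ‖(1 + Complex.I * x) - (1 + Complex.I * m)‖ = ‖x - m‖ := by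
    intro x
    rw [add_sub_add_left_eq_sub, ← mul_sub, norm_mul, Complex.norm_I, one_mul]
  have hs : m ≤ ‖1 + Complex.I * (m : ℂ)‖ := by
    have := Complex.im_le_norm (1 + Complex.I * (m : ℂ))
    simpa using this
  set s : ℝ := ‖1 + Complex.I * (m : ℂ)‖
  have h1 : ‖1 + Complex.I * τ‖ ≤ s + r := by
    have := norm_le_norm_add_norm_sub' (1 + Complex.I * τ) (1 + Complex.I * (m : ℂ))
    rw [hshift] at this
    linarith
  have h2 : s - r ≤ ‖1 + Complex.I * σ‖ := by
    have := norm_le_norm_add_norm_sub (1 + Complex.I * σ) (1 + Complex.I * (m : ℂ))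
    rw [hshift] at this
    linarith
  refine ⟨norm_pos_iff.1 (by linarith), ?_⟩
  have h3 := mul_le_mul_of_nonneg_left h1 hα.le
  have h4 := mul_le_mul_of_nonneg_left h2 (hα.le.trans hαβ)
  have h5 : r * m ≤ r * s := mul_le_mul_of_nonneg_left hs (by linarith)
  have h6 : α * (s + r) ≤ β * (s - r) := by
    have e1 : α = m - r := by rw [hm, hr]; ring
    have e2 : β = m + r := by rw [hm, hr]; ring
    rw [e1, e2]
    linarith
  linarith

lemma norm_acuteFunctional_div_sub_le {Vr : Submodule ℝ V} {Cr : Set V} {α β : ℝ} {p q : V}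
    (hp : p ∈ Vr) (hq : q ∈ Vr) (hαβ : α ≤ β) (h : IsPinched Vr Cr α β p q)
    {F : V →ₗ[ℂ] ℂ} (hF : F ∈ acuteFunctionals Vr Cr) (hFp : F p ≠ 0) :
    ‖F q / F p - ((α + β) / 2 : ℝ)‖ ≤ (β - α) / 2 := by
  have h1 : F q / F p - ((α + β) / 2 : ℝ) = (F q - ((α + β) / 2 : ℝ) * F p) / F p := by
    field_simp
  rw [h1, norm_div, div_le_iff₀ (norm_pos_iff.2 hFp)]
  exact norm_acuteFunctional_sub_le hp hq hαβ h hF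

/-- Ratios of two acute functionals vary by a factor at most `β / α` between real vectors. -/
lemma acuteFunctional_ratio_le {Vr : Submodule ℝ V} {Cr : Set V} {α β : ℝ} {p q : V}
    (hp : p ∈ Vr) (hq : q ∈ Vr) (hα : 0 < α) (hαβ : α ≤ β) (h : IsPinched Vr Cr α β p q)
    {F G : V →ₗ[ℂ] ℂ} (hF : F ∈ acuteFunctionals Vr Cr) (hFp : F p ≠ 0)
    (hG : G ∈ acuteFunctionals Vr Cr) (hGp : G p ≠ 0) :
    ‖F q / F p‖ ≤ β / α * ‖G q / G p‖ := by
  have h1 := norm_acuteFunctional_div_sub_le hp hq hαβ h hF hFp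
  have h2 := norm_acuteFunctional_div_sub_le hp hq hαβ h hG hGp
  have hm : ‖(((α + β) / 2 : ℝ) : ℂ)‖ = (α + β) / 2 := by
    rw [Complex.norm_real, Real.norm_of_nonneg (by linarith)]
  have h3 := norm_le_norm_add_norm_sub' (F q / F p) (((α + β) / 2 : ℝ) : ℂ)
  have h4 := norm_le_norm_add_norm_sub (G q / G p) (((α + β) / 2 : ℝ) : ℂ)
  rw [hm] at h3 h4
  calc ‖F q / F p‖ ≤ β / α * α := by rw [div_mul_cancel₀ _ hα.ne']; linarith
    _ ≤ _ := mul_le_mul_of_nonneg_left (by linarith) (div_nonneg (hα.le.trans hαβ) hα.le)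

/-- Ratios of two acute functionals vary by a factor at most `β / α` between a complex vector
`p + i q` and its real part. -/
lemma acuteFunctional_complex_ratio_le {Vr : Submodule ℝ V} {Cr : Set V} {α β : ℝ} {p q : V}
    (hp : p ∈ Vr) (hq : q ∈ Vr) (hα : 0 < α) (hαβ : α ≤ β) (h : IsPinched Vr Cr α β p q)
    {F G : V →ₗ[ℂ] ℂ} (hF : F ∈ acuteFunctionals Vr Cr) (hFp : F p ≠ 0)
    (hG : G ∈ acuteFunctionals Vr Cr) (hGp : G p ≠ 0) :
    G (p + Complex.I • q) / G p ≠ 0 ∧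
      ‖F (p + Complex.I • q) / F p‖ ≤ β / α * ‖G (p + Complex.I • q) / G p‖ := by
  have hval : ∀ F : V →ₗ[ℂ] ℂ, F p ≠ 0 →
      F (p + Complex.I • q) / F p = 1 + Complex.I * (F q / F p) := by
    intro F hFp
    rw [map_add, map_smul, smul_eq_mul]
    field_simp
  obtain ⟨h1, h2⟩ := norm_one_add_I_mul_le hα hαβ
    (norm_acuteFunctional_div_sub_le hp hq hαβ h hF hFp)
    (norm_acuteFunctional_div_sub_le hp hq hαβ h hG hGp)
  rw [hval F hFp, hval G hGp]
  refine ⟨h1, ?_⟩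
  rw [div_mul_eq_mul_div, le_div_iff₀ hα]
  linarith

/-- A nonzero complex multiple of `p + i q`, with `p, q` in a set `S` of pairwise comparable real
vectors or zero, is projectively close to some element of `S`. -/
lemma exists_real_projectively_close {Vr : Submodule ℝ V} {Cr S : Set V} {K : ℝ} (hK : 1 ≤ K)
    (hSVr : S ⊆ (Vr : Set V))
    (hS : ∀ p ∈ S, ∀ q ∈ S, ∃ α β : ℝ, 0 < α ∧ α ≤ β ∧ β ≤ K * α ∧ IsPinched Vr Cr α β p q)
    {x : V} (hx0 : x ≠ 0) {c : ℂ} (hc : c ≠ 0) {p q : V} (hp : p ∈ S ∨ p = 0) (hq : q ∈ S ∨ q = 0)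
    (hx : x = c • (p + Complex.I • q)) :
    ∃ s ∈ S, ∀ F ∈ acuteFunctionals Vr Cr, ∀ G ∈ acuteFunctionals Vr Cr, F s ≠ 0 → G s ≠ 0 →
      G x / G s ≠ 0 ∧ ‖F x / F s‖ ≤ K * ‖G x / G s‖ := by
  have hline : ∀ s ∈ S, ∀ d : ℂ, d ≠ 0 → x = d • s →
      ∃ s ∈ S, ∀ F ∈ acuteFunctionals Vr Cr, ∀ G ∈ acuteFunctionals Vr Cr, F s ≠ 0 → G s ≠ 0 →
      G x / G s ≠ 0 ∧ ‖F x / F s‖ ≤ K * ‖G x / G s‖ := by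
    rintro s hs d hd rfl
    refine ⟨s, hs, fun F _ G _ hFs hGs => ?_⟩
    rw [map_smul, map_smul, smul_eq_mul, smul_eq_mul, mul_div_cancel_right₀ _ hFs,
      mul_div_cancel_right₀ _ hGs]
    exact ⟨hd, le_mul_of_one_le_left (norm_nonneg _) hK⟩
  rcases hp with hp | rfl
  · rcases hq with hq | rfl
    · refine ⟨p, hp, fun F hF G hG hFp hGp => ?_⟩
      obtain ⟨α, β, hα, hαβ, hβ, hpinch⟩ := hS p hp q hq
      obtain ⟨h1, h2⟩ := acuteFunctional_complex_ratio_le (hSVr hp) (hSVr hq) hα hαβ hpinch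
        hF hFp hG hGp
      have hsc : ∀ F : V →ₗ[ℂ] ℂ, F x / F p = c * (F (p + Complex.I • q) / F p) := by
        intro F
        rw [hx, map_smul, smul_eq_mul, mul_div_assoc]
      rw [hsc F, hsc G, norm_mul, norm_mul, mul_left_comm]
      refine ⟨mul_ne_zero hc h1, mul_le_mul_of_nonneg_left (h2.trans ?_) (norm_nonneg c)⟩
      exact mul_le_mul_of_nonneg_right ((div_le_iff₀ hα).2 hβ) (norm_nonneg _)
    · exact hline p hp c hc (by rw [hx, smul_zero, add_zero])
  · rcases hq with hq | rfl
    · exact hline q hq (c * Complex.I) (mul_ne_zero hc Complex.I_ne_zero)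
        (by rw [hx, zero_add, smul_smul])
    · exact absurd (by rw [hx, smul_zero, add_zero, smul_zero]) hx0

/-- Points of `E_C(x, y)` are quotients `F y / F x` of acute functionals that do not vanish on
comparable real vectors. -/
lemma exists_acuteFunctional_of_mem_ECset {Vr : Submodule ℝ V} {Cr S : Set V}
    (hSpan : ∀ x : V, ∃ u ∈ Vr, ∃ v ∈ Vr, x = u + Complex.I • v)
    (hCrSub : Cr ⊆ (Vr : Set V)) (hCrProper : ∀ u ∈ Cr, -u ∈ Cr → u = 0)
    (hsep : ∀ x ∈ Vr, x ∉ Cr → ∃ l ∈ positiveFunctionals Vr Cr, (l x).re < 0)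
    (hSCr : S ⊆ Cr) (hS0 : ∀ p ∈ S, p ≠ 0)
    (hS : ∀ p ∈ S, ∀ q ∈ S, ∃ α β : ℝ, 0 < α ∧ IsPinched Vr Cr α β p q)
    {x y s₀ : V} (hs₀ : s₀ ∈ S)
    (hxS : x ∈ Submodule.span ℂ S) (hyS : y ∈ Submodule.span ℂ S) {z : ℂ}
    (hz : z ∈ ECset (complexCone Cr) x y) :
    ∃ F ∈ acuteFunctionals Vr Cr, (∀ p ∈ S, F p ≠ 0) ∧ F y = z * F x := by
  have hreal : ∀ l ∈ positiveFunctionals Vr Cr, ∀ p ∈ S, l p = ((l p).re : ℂ) := fun l hl p hp =>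
    Complex.ext rfl (by simpa using hl.1 p (hCrSub (hSCr hp)))
  have hvanish : ∀ l ∈ positiveFunctionals Vr Cr, ∀ p ∈ S, l p = 0 →
      ∀ w ∈ Submodule.span ℂ S, l w = 0 := by
    intro l hl p hp hlp w hw
    have hle : Submodule.span ℂ S ≤ LinearMap.ker l := by
      refine Submodule.span_le.2 fun q hq => ?_
      obtain ⟨α, β, -, h⟩ := hS p hp q hq
      have := h l hl
      rw [hlp, Complex.zero_re, mul_zero, mul_zero] at this
      rw [SetLike.mem_coe, LinearMap.mem_ker, hreal l hl q hq, le_antisymm this.2 this.1,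
        Complex.ofReal_zero]
    exact hle hw
  by_cases hw0 : z • x - y = 0
  · obtain ⟨l, hl, hlt⟩ := hsep (-s₀) (Vr.neg_mem (hCrSub (hSCr hs₀)))
      fun hn => hS0 s₀ hs₀ (hCrProper s₀ (hSCr hs₀) hn)
    refine ⟨l, positiveFunctionals_subset_acuteFunctionals Vr Cr hl, fun p hp hlp => ?_, ?_⟩
    · rw [map_neg, hvanish l hl p hp hlp s₀ (Submodule.subset_span hs₀)] at hlt
      simp at hlt
    · rw [← sub_eq_zero.1 hw0, map_smul, smul_eq_mul]
  obtain ⟨l₁, h₁, l₂, h₂, hlt⟩ := exists_obtuse_pair_of_notMem_complexCone hSpan hsep hw0 hz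
  set w := z • x - y with hw
  have hwS : w ∈ Submodule.span ℂ S := Submodule.sub_mem _ (Submodule.smul_mem _ _ hxS) hyS
  have hpos : 0 < (l₂ w * (starRingEnd ℂ) (-l₁ w)).re := by
    simp only [Complex.mul_re, Complex.conj_re, Complex.conj_im, Complex.neg_re,
      Complex.neg_im] at hlt ⊢
    linarith
  refine ⟨l₂ w • l₁ + (-l₁ w) • l₂, ⟨l₁, h₁, l₂, h₂, l₂ w, -l₁ w, hpos.le, rfl⟩, ?_, ?_⟩
  · intro p hp h0
    have hne : l₁ p ≠ 0 := fun h => by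
      rw [hvanish l₁ h₁ p hp h w hwS] at hlt
      simp at hlt
    have hne₂ : l₂ w ≠ 0 := fun h => by
      rw [h] at hlt
      simp at hlt
    rw [LinearMap.add_apply, LinearMap.smul_apply, LinearMap.smul_apply, smul_eq_mul, smul_eq_mul,
      hreal l₁ h₁ p hp, hreal l₂ h₂ p hp] at h0
    have hp1 : 0 < (l₁ p).re := lt_of_le_of_ne (h₁.2 p (hSCr hp)) fun h => hne (by
      rw [hreal l₁ h₁ p hp, ← h, Complex.ofReal_zero])
    have hp2 := h₂.2 p (hSCr hp)
    have h3 : Complex.normSq (l₂ w) * (l₁ p).re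
        + (l₂ w * (starRingEnd ℂ) (-l₁ w)).re * (l₂ p).re = 0 := by
      have := congrArg Complex.re (congrArg (fun t => (starRingEnd ℂ) (l₂ w) * t) h0)
      simp only [Complex.mul_re, Complex.mul_im, Complex.add_re, Complex.add_im, Complex.conj_re,
        Complex.conj_im, Complex.neg_re, Complex.neg_im, Complex.ofReal_re, Complex.ofReal_im,
        Complex.zero_re, Complex.zero_im, Complex.normSq_apply] at this ⊢
      linarith
    have h4 : 0 < Complex.normSq (l₂ w) * (l₁ p).re := mul_pos (Complex.normSq_pos.2 hne₂) hp1
    have h5 := mul_nonneg hpos.le hp2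
    linarith
  · have h0 : (l₂ w • l₁ + (-l₁ w) • l₂) w = 0 := by
      simp only [LinearMap.add_apply, LinearMap.smul_apply, smul_eq_mul]
      ring
    have h1 : z * (l₂ w • l₁ + (-l₁ w) • l₂) x = (l₂ w • l₁ + (-l₁ w) • l₂) y := by
      rw [← smul_eq_mul, ← map_smul]
      refine sub_eq_zero.1 ?_
      rw [← map_sub]
      exact h0
    exact h1.symm

/-- A bound on the quotients of moduli of points of `E_C(x, y)` bounds `δ_C(x, y)`. -/
lemma deltaC_le_of_norm_le {Cc : Set V} {x y : V} {D : ℝ}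
    (h : ∀ z ∈ ECset Cc x y, ∀ z' ∈ ECset Cc x y, ‖z‖ ≤ Real.exp D * ‖z'‖) :
    deltaC Cc x y ≤ (D : EReal) := by
  have hratio : (⨆ z ∈ ECset Cc x y, (‖z‖₊ : ENNReal)) / (⨅ z ∈ ECset Cc x y, (‖z‖₊ : ENNReal))
      ≤ ENNReal.ofReal (Real.exp D) := by
    refine ENNReal.div_le_of_le_mul (iSup₂_le fun z hz => ?_)
    have hpos : ENNReal.ofReal (Real.exp D) ≠ 0 := by simpa using Real.exp_pos D
    rw [mul_comm, ← ENNReal.div_le_iff hpos ENNReal.ofReal_ne_top]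
    refine le_iInf₂ fun z' hz' => ?_
    rw [ENNReal.div_le_iff hpos ENNReal.ofReal_ne_top, mul_comm]
    simp only [← enorm_eq_nnnorm, ← ofReal_norm]
    rw [← ENNReal.ofReal_mul (Real.exp_pos D).le]
    exact ENNReal.ofReal_le_ofReal (h z hz z' hz')
  unfold deltaC elog
  split_ifs with h0 ht
  · exact bot_le
  · rw [ht] at hratio
    exact absurd (top_le_iff.1 hratio) ENNReal.ofReal_ne_top
  · rw [EReal.coe_le_coe_iff, Real.log_le_iff_le_exp (ENNReal.toReal_pos h0 ht)]
    exact ENNReal.toReal_le_of_le_ofReal (Real.exp_pos D).le hratio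

end

/-- a real positive operator extends to the complexified cone, and the
diameter of the image of the complex cone is at most three times the real Hilbert diameter. -/
theorem complex_diameter_le_three_real_diameter
    {V : Type*} [NormedAddCommGroup V] [NormedSpace ℂ V]
    (Vr : Submodule ℝ V) (hVrClosed : IsClosed (Vr : Set V))
    (hSpan : ∀ x : V, ∃ u ∈ Vr, ∃ v ∈ Vr, x = u + Complex.I • v)
    (hUniq : ∀ u ∈ Vr, ∀ v ∈ Vr, u + Complex.I • v = 0 → u = 0 ∧ v = 0)
    (Cr : Set V) (hCrSub : Cr ⊆ (Vr : Set V)) (hCrClosed : IsClosed Cr)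
    (hCrAdd : ∀ u ∈ Cr, ∀ v ∈ Cr, u + v ∈ Cr)
    (hCrSmul : ∀ t : ℝ, 0 ≤ t → ∀ u ∈ Cr, t • u ∈ Cr)
    (hCrProper : ∀ u ∈ Cr, -u ∈ Cr → u = 0)
    (hCrNontriv : ∃ u ∈ Cr, ∃ v ∈ Cr, LinearIndependent ℝ ![u, v])
    (P : V →ₗ[ℂ] V) (hPVr : ∀ u ∈ Vr, P u ∈ Vr)
    (hPCr : ∀ u ∈ Cr, u ≠ 0 → P u ∈ Cr ∧ P u ≠ 0) :
    (∀ w ∈ complexCone Cr, P w ∈ complexCone Cr) ∧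
    (⨆ w ∈ complexCone Cr, ⨆ w' ∈ complexCone Cr,
        deltaC (complexCone Cr) (P w) (P w'))
      ≤ (3 : EReal) * ⨆ u ∈ {u | u ∈ Cr ∧ u ≠ 0}, ⨆ v ∈ {v | v ∈ Cr ∧ v ≠ 0},
          hilbertMetric Cr (P u) (P v) := by
  have hmap : ∀ w ∈ complexCone Cr, P w ∈ complexCone Cr := by
    rintro _ ⟨hw0, c, hc, u, hu, v, hv, rfl⟩
    have hPmem : ∀ u ∈ Cr, P u ∈ Cr := fun u hu => by
      by_cases h : u = 0
      · rwa [h, map_zero, ← h]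
      · exact (hPCr u hu h).1
    have himg : P (c • (u + Complex.I • v)) = c • (P u + Complex.I • P v) := by
      rw [map_smul, map_add, map_smul]
    refine ⟨fun h0 => hw0 ?_, c, hc, P u, hPmem u hu, P v, hPmem v hv, himg⟩
    rw [himg] at h0
    obtain ⟨h1, h2⟩ := hUniq _ (hPVr u (hCrSub hu)) _ (hPVr v (hCrSub hv))
      ((smul_eq_zero.1 h0).resolve_left hc)
    have hu0 : u = 0 := by_contra fun h => (hPCr u hu h).2 h1
    have hv0 : v = 0 := by_contra fun h => (hPCr v hv h).2 h2
    rw [hu0, hv0, smul_zero, add_zero, smul_zero]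
  refine ⟨hmap, ?_⟩
  obtain ⟨u₀, hu₀, v₀, -, hind⟩ := hCrNontriv
  have hu₀0 : u₀ ≠ 0 := hind.ne_zero 0
  have hsep : ∀ x ∈ Vr, x ∉ Cr → ∃ l ∈ positiveFunctionals Vr Cr, (l x).re < 0 :=
    fun x hx hxC => exists_positiveFunctional_neg hSpan hUniq hCrSub hCrClosed ⟨u₀, hu₀⟩
      hCrAdd hCrSmul hx hxC
  set Δ : EReal := ⨆ u ∈ {u | u ∈ Cr ∧ u ≠ 0}, ⨆ v ∈ {v | v ∈ Cr ∧ v ≠ 0},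
    hilbertMetric Cr (P u) (P v) with hΔ
  have hle : ∀ u ∈ Cr, u ≠ 0 → ∀ v ∈ Cr, v ≠ 0 → hilbertMetric Cr (P u) (P v) ≤ Δ :=
    fun u hu hu0 v hv hv0 => (le_iSup₂_of_le u ⟨hu, hu0⟩
      (le_iSup₂_of_le v ⟨hv, hv0⟩ le_rfl))
  have hpinch : ∀ D : ℝ, Δ ≤ (D : EReal) → ∀ u ∈ Cr, u ≠ 0 → ∀ v ∈ Cr, v ≠ 0 →
      ∃ α β : ℝ, 0 < α ∧ α ≤ β ∧ β ≤ Real.exp D * α ∧ IsPinched Vr Cr α β (P u) (P v) :=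
    fun D hD u hu hu0 v hv hv0 => exists_isPinched_of_hilbertMetric_le hCrSub hCrProper hsep
      (hPCr u hu hu0).1 (hPCr u hu hu0).2 (hPCr v hv hv0).1 (hPCr v hv hv0).2
      ((hle u hu hu0 v hv hv0).trans hD)
  have hnonneg : ∀ D : ℝ, Δ ≤ (D : EReal) → 1 ≤ Real.exp D := by
    intro D hD
    obtain ⟨α, β, hα, hαβ, hβ, -⟩ := hpinch D hD u₀ hu₀ hu₀0 u₀ hu₀ hu₀0
    exact le_of_mul_le_mul_right (by linarith) hα
  by_cases hΔt : Δ = ⊤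
  · rw [hΔt, EReal.mul_top_of_pos (by norm_num)]
    exact le_top
  have hΔb : Δ ≠ ⊥ := by
    intro hb
    have := hnonneg (-1) (by rw [hb]; exact bot_le)
    rw [Real.one_le_exp_iff] at this
    linarith
  obtain ⟨D, hD⟩ : ∃ D : ℝ, (D : EReal) = Δ := ⟨Δ.toReal, EReal.coe_toReal hΔt hΔb⟩
  have hK := hnonneg D hD.ge
  set S : Set V := P '' {u | u ∈ Cr ∧ u ≠ 0} with hSdef
  have hSCr : S ⊆ Cr := by
    rintro _ ⟨u, hu, rfl⟩
    exact (hPCr u hu.1 hu.2).1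
  have hS0 : ∀ p ∈ S, p ≠ 0 := by
    rintro _ ⟨u, hu, rfl⟩
    exact (hPCr u hu.1 hu.2).2
  have hS : ∀ p ∈ S, ∀ q ∈ S,
      ∃ α β : ℝ, 0 < α ∧ α ≤ β ∧ β ≤ Real.exp D * α ∧ IsPinched Vr Cr α β p q := by
    rintro _ ⟨u, hu, rfl⟩ _ ⟨v, hv, rfl⟩
    exact hpinch D hD.ge u hu.1 hu.2 v hv.1 hv.2
  have hSVr : S ⊆ (Vr : Set V) := hSCr.trans hCrSub
  have hreal : ∀ w ∈ complexCone Cr, P w ∈ Submodule.span ℂ S ∧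
      ∃ s ∈ S, ∀ F ∈ acuteFunctionals Vr Cr, ∀ G ∈ acuteFunctionals Vr Cr, F s ≠ 0 → G s ≠ 0 →
        G (P w) / G s ≠ 0 ∧ ‖F (P w) / F s‖ ≤ Real.exp D * ‖G (P w) / G s‖ := by
    intro w hw
    have hPw0 := (hmap w hw).1
    obtain ⟨hw0, c, hc, u, hu, v, hv, rfl⟩ := hw
    have himg : P (c • (u + Complex.I • v)) = c • (P u + Complex.I • P v) := by
      rw [map_smul, map_add, map_smul]
    have hmem : ∀ u ∈ Cr, P u ∈ S ∨ P u = 0 := fun u hu => by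
      by_cases h : u = 0
      · exact Or.inr (by rw [h, map_zero])
      · exact Or.inl ⟨u, ⟨hu, h⟩, rfl⟩
    have hspan : ∀ u ∈ Cr, P u ∈ Submodule.span ℂ S := fun u hu =>
      (hmem u hu).elim (fun h => Submodule.subset_span h) fun h => h ▸ Submodule.zero_mem _
    refine ⟨?_, exists_real_projectively_close hK hSVr hS hPw0 hc (hmem u hu) (hmem v hv) himg⟩
    rw [himg]
    exact Submodule.smul_mem _ _
      (Submodule.add_mem _ (hspan u hu) (Submodule.smul_mem _ _ (hspan v hv)))
  refine iSup₂_le fun w hw => iSup₂_le fun w' hw' => ?_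
  rw [← hD]
  have h3D : (3 : EReal) * (D : EReal) = ((3 * D : ℝ) : EReal) := by norm_cast
  rw [h3D]
  refine deltaC_le_of_norm_le fun z hz z' hz' => ?_
  obtain ⟨hxS, s, hs, hxs⟩ := hreal w hw
  obtain ⟨hyS, t, ht, hyt⟩ := hreal w' hw'
  have hS' : ∀ p ∈ S, ∀ q ∈ S, ∃ α β : ℝ, 0 < α ∧ IsPinched Vr Cr α β p q := fun p hp q hq => by
    obtain ⟨α, β, hα, -, -, h⟩ := hS p hp q hq
    exact ⟨α, β, hα, h⟩
  obtain ⟨F, hF, hF0, hFz⟩ := exists_acuteFunctional_of_mem_ECset hSpan hCrSub hCrProper hsep hSCr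
    hS0 hS' hs hxS hyS hz
  obtain ⟨G, hG, hG0, hGz⟩ := exists_acuteFunctional_of_mem_ECset hSpan hCrSub hCrProper hsep hSCr
    hS0 hS' hs hxS hyS hz'
  obtain ⟨hFx, hGF⟩ := hxs G hG F hF (hG0 s hs) (hF0 s hs)
  obtain ⟨hGx, -⟩ := hxs F hF G hG (hF0 s hs) (hG0 s hs)
  obtain ⟨-, hFG⟩ := hyt F hF G hG (hF0 t ht) (hG0 t ht)
  obtain ⟨α, β, hα, hαβ, hβ, hst⟩ := hS s hs t ht
  have hmid : ‖F t / F s‖ ≤ Real.exp D * ‖G t / G s‖ :=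
    (acuteFunctional_ratio_le (hSVr hs) (hSVr ht) hα hαβ hst hF (hF0 s hs) hG (hG0 s hs)).trans
      (mul_le_mul_of_nonneg_right ((div_le_iff₀ hα).2 hβ) (norm_nonneg _))
  have hquot : ∀ H : V →ₗ[ℂ] ℂ, ∀ ζ : ℂ, (∀ p ∈ S, H p ≠ 0) → H (P w') = ζ * H (P w) →
      H (P w) / H s ≠ 0 → ‖ζ‖ * ‖H (P w) / H s‖ = ‖H (P w') / H t‖ * ‖H t / H s‖ := by
    intro H ζ hH hζ hne
    have hs0 := hH s hs
    have ht0 := hH t ht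
    rw [← norm_mul, ← norm_mul, hζ]
    congr 1
    field_simp
  have hFq := hquot F z hF0 hFz hFx
  have hGq := hquot G z' hG0 hGz hGx
  have hFpos : 0 < ‖F (P w) / F s‖ := norm_pos_iff.2 hFx
  refine le_of_mul_le_mul_right ?_ hFpos
  calc ‖z‖ * ‖F (P w) / F s‖ = ‖F (P w') / F t‖ * ‖F t / F s‖ := hFq
    _ ≤ (Real.exp D * ‖G (P w') / G t‖) * (Real.exp D * ‖G t / G s‖) :=
      mul_le_mul hFG hmid (norm_nonneg _) (by positivity)
    _ = Real.exp D * Real.exp D * (‖z'‖ * ‖G (P w) / G s‖) := by rw [hGq]; ring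
    _ ≤ Real.exp D * Real.exp D * (‖z'‖ * (Real.exp D * ‖F (P w) / F s‖)) := by gcongr
    _ = Real.exp (3 * D) * ‖z'‖ * ‖F (P w) / F s‖ := by
      rw [show 3 * D = D + D + D by ring, Real.exp_add, Real.exp_add]
      ring
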